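/- Two BDTs φ and ψ over the variables x₁, …, xₙ are equivalent if and only if their λ⊕⊸ encodings are equivalent proofs: φ ∼ ψ ⟺ ⟦φ⟧ ∼ ⟦ψ⟧ (i.e., 𝒮(⟦φ⟧) = 𝒮(⟦ψ⟧)). -/

import Mathlib

/-- Formulas of the intuitionistic multiplicative-additive calculus λ⊕⊸:
atoms, labeled sums `⊕ₓ`, and linear implication `⊸`. -/
inductive Formula : Type
  | atom : ℕ → Formula
  | oplus : ℕ → Formula → Formula → Formula
  | limp : Formula → Formula → Formula
deriving DecidableEq

namespace Formula

/-- Number of atom occurrences of a formula. -/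
def size : Formula → ℕ
  | atom _ => 1
  | oplus _ A B => A.size + B.size
  | limp A B => A.size + B.size

/-- The list of Boolean-variable labels of the `⊕` occurrences of a formula. -/
def labels : Formula → List ℕ
  | atom _ => []
  | oplus x A B => x :: (A.labels ++ B.labels)
  | limp A B => A.labels ++ B.labels

end Formula

/-- Number of atom occurrences of a context. -/
def csz (Γ : List Formula) : ℕ := (Γ.map Formula.size).sum

/-- All labels of `⊕` occurrences of a sequent `Γ ⊢ C`. -/
def seqLabels (Γ : List Formula) (C : Formula) : List ℕ :=
  (Γ.map Formula.labels).flatten ++ C.labels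

/-- Cut-free, η-expanded sequent calculus proofs of λ⊕⊸. -/
inductive Proof : List Formula → Formula → Type
  | ax (a : ℕ) : Proof [.atom a] (.atom a)
  | limpR {Γ : List Formula} {A B : Formula} :
      Proof (Γ ++ [A]) B → Proof Γ (.limp A B)
  | limpL {Γ Δ : List Formula} {A B C : Formula} :
      Proof Γ A → Proof (B :: Δ) C → Proof (Γ ++ .limp A B :: Δ) C
  | ex (Γ₁ Γ₂ Γ₃ : List Formula) (A B : Formula) {C : Formula} :
      Proof (Γ₁ ++ A :: (Γ₂ ++ B :: Γ₃)) C → Proof (Γ₁ ++ B :: (Γ₂ ++ A :: Γ₃)) C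
  | oplusR1 (x : ℕ) {Γ : List Formula} {A B : Formula} :
      Proof Γ A → Proof Γ (.oplus x A B)
  | oplusR2 (x : ℕ) {Γ : List Formula} {A B : Formula} :
      Proof Γ B → Proof Γ (.oplus x A B)
  | oplusL (x : ℕ) {Γ : List Formula} {A B C : Formula} :
      Proof (Γ ++ [A]) C → Proof (Γ ++ [B]) C → Proof (Γ ++ [.oplus x A B]) C

/-- Atom occurrences of a sequent `Γ ⊢ C` are identified with the positions
`0, 1, 2, …` in the left-to-right flattening of `Γ` followed by `C`.
A slice is a finite set of unordered pairs of such positions. -/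
abbrev Slice := Finset (Sym2 ℕ)

/-- Reindexing the atom occurrences of a slice along a map of positions. -/
def Slice.reindex (f : ℕ → ℕ) (l : Slice) : Slice := l.image (Sym2.map f)

/-- Position reindex for the exchange rule: maps the positions of the layout
`[a-block][p-block][b-block][q-block]rest` to those of `[a-block][q-block][b-block][p-block]rest`. -/
def swapMap (a p b q : ℕ) (i : ℕ) : ℕ :=
  if i < a then i
  else if i < a + p then i + q + b
  else if i < a + p + b then i - p + q
  else if i < a + p + b + q then i - p - b
  else i

/-- The slicing 𝒮(π) of a λ⊕⊸ proof. -/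
def Proof.slicing : {Γ : List Formula} → {C : Formula} → Proof Γ C → Finset Slice
  | _, _, .ax _ => {({s(0, 1)} : Slice)}
  | _, _, .limpR p => p.slicing
  | _, _, @Proof.limpL Γ _ A _ _ p q =>
      Finset.image₂ (fun l m => l ∪ Slice.reindex (fun i => i + (csz Γ + A.size)) m)
        p.slicing q.slicing
  | _, _, @Proof.ex Γ₁ Γ₂ _ A B _ p =>
      p.slicing.image (Slice.reindex (swapMap (csz Γ₁) A.size (csz Γ₂) B.size))
  | _, _, .oplusR1 _ p => p.slicing
  | _, _, @Proof.oplusR2 _ Γ A _ p =>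
      p.slicing.image (Slice.reindex (fun i => if i < csz Γ then i else i + A.size))
  | _, _, @Proof.oplusL _ Γ A B _ p q =>
      p.slicing.image (Slice.reindex (fun i => if i < csz Γ + A.size then i else i + B.size))
      ∪ q.slicing.image (Slice.reindex (fun i => if i < csz Γ then i else i + A.size))

/-- Binary decision trees: leaves labeled `0`/`1` (as `Bool`), inner vertices labeled
by Boolean variables; `node x l r` has left subtree `l` and right subtree `r`. -/
inductive BDT : Type
  | leaf : Bool → BDT
  | node : ℕ → BDT → BDT → BDT
deriving DecidableEq

namespace BDT

/-- Evaluation of a BDT under a valuation: go left when the variable is `false` (0),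
right when it is `true` (1). -/
def eval (v : ℕ → Bool) : BDT → Bool
  | leaf b => b
  | node x l r => if v x then r.eval v else l.eval v

/-- Two BDTs are equivalent when they compute the same Boolean function. -/
def Equiv (φ ψ : BDT) : Prop := ∀ v : ℕ → Bool, φ.eval v = ψ.eval v

/-- Variables occurring in a BDT. -/
def vars : BDT → Finset ℕ
  | leaf _ => ∅
  | node x l r => insert x (l.vars ∪ r.vars)

/-- A BDT is free when no variable occurs twice on a path from the root to a leaf. -/
def Free : BDT → Prop
  | leaf _ => True
  | node x l r => x ∉ l.vars ∧ x ∉ r.vars ∧ l.Free ∧ r.Free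

/-- Negation of a BDT: swap the 0/1 labels at the leaves. -/
def neg : BDT → BDT
  | leaf b => leaf !b
  | node x l r => node x l.neg r.neg

end BDT

/-- The BDT slicing B(π) of a proof, as a function of two atom positions of the
conclusion sequent (it is symmetric in the two positions, and `0` on positions
that do not correspond to a pair of atoms of the sequent). -/
def Proof.bdt : {Γ : List Formula} → {C : Formula} → Proof Γ C → ℕ → ℕ → BDT
  | _, _, .ax _, i, j =>
      if (i = 0 ∧ j = 1) ∨ (i = 1 ∧ j = 0) then .leaf true else .leaf false
  | _, _, .limpR p, i, j => p.bdt i j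
  | _, _, @Proof.limpL Γ _ A _ _ p q, i, j =>
      if i < csz Γ + A.size ∧ j < csz Γ + A.size then p.bdt i j
      else if csz Γ + A.size ≤ i ∧ csz Γ + A.size ≤ j then
        q.bdt (i - (csz Γ + A.size)) (j - (csz Γ + A.size))
      else .leaf false
  | _, _, @Proof.ex Γ₁ Γ₂ _ A B _ p, i, j =>
      p.bdt (swapMap (csz Γ₁) B.size (csz Γ₂) A.size i)
            (swapMap (csz Γ₁) B.size (csz Γ₂) A.size j)
  | _, _, @Proof.oplusR1 _ Γ A _ p, i, j =>
      if i < csz Γ + A.size ∧ j < csz Γ + A.size then p.bdt i j else .leaf false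
  | _, _, @Proof.oplusR2 _ Γ A _ p, i, j =>
      if (i < csz Γ ∨ csz Γ + A.size ≤ i) ∧ (j < csz Γ ∨ csz Γ + A.size ≤ j) then
        p.bdt (if i < csz Γ then i else i - A.size) (if j < csz Γ then j else j - A.size)
      else .leaf false
  | _, _, @Proof.oplusL x Γ A B _ p q, i, j =>
      if ((csz Γ ≤ i ∧ i < csz Γ + A.size) ∧ (csz Γ + A.size ≤ j ∧ j < csz Γ + A.size + B.size)) ∨
         ((csz Γ ≤ j ∧ j < csz Γ + A.size) ∧ (csz Γ + A.size ≤ i ∧ i < csz Γ + A.size + B.size)) then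
        .leaf false
      else if (csz Γ ≤ i ∧ i < csz Γ + A.size) ∨ (csz Γ ≤ j ∧ j < csz Γ + A.size) then
        .node x (p.bdt (if i < csz Γ + A.size then i else i - B.size)
                       (if j < csz Γ + A.size then j else j - B.size)) (.leaf false)
      else if (csz Γ + A.size ≤ i ∧ i < csz Γ + A.size + B.size) ∨
              (csz Γ + A.size ≤ j ∧ j < csz Γ + A.size + B.size) then
        .node x (.leaf false) (q.bdt (if i < csz Γ then i else i - A.size)
                                     (if j < csz Γ then j else j - A.size))
      else
        .node x (p.bdt (if i < csz Γ + A.size then i else i - B.size)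
                       (if j < csz Γ + A.size then j else j - B.size))
                (q.bdt (if i < csz Γ then i else i - A.size)
                       (if j < csz Γ then j else j - A.size))

/-- Smaller element of an unordered pair of positions. -/
def pmin (p : Sym2 ℕ) : ℕ := Sym2.lift ⟨fun a b => min a b, fun a b => min_comm a b⟩ p
/-- Larger element of an unordered pair of positions. -/
def pmax (p : Sym2 ℕ) : ℕ := Sym2.lift ⟨fun a b => max a b, fun a b => max_comm a b⟩ p

/-- The BDT slicing B(π) at an unordered pair of atom positions. -/
def Proof.bdtAt {Γ : List Formula} {C : Formula} (π : Proof Γ C) (p : Sym2 ℕ) : BDT :=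
  π.bdt (pmin p) (pmax p)

/-- The slice obtained by evaluating the BDT slicing of `π` under a valuation `v`:
the set of pairs whose BDT evaluates to `1`. -/
def Proof.vslice {Γ : List Formula} {C : Formula} (π : Proof Γ C) (v : ℕ → Bool) :
    Set (Sym2 ℕ) :=
  {p : Sym2 ℕ | (π.bdtAt p).eval v = true}

/-- The labels of the `⊕†` rules of a proof (its Boolean variables). -/
def Proof.labels : {Γ : List Formula} → {C : Formula} → Proof Γ C → List ℕ
  | _, _, .ax _ => []
  | _, _, .limpR p => p.labels
  | _, _, .limpL p q => p.labels ++ q.labels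
  | _, _, .ex _ _ _ _ _ p => p.labels
  | _, _, .oplusR1 _ p => p.labels
  | _, _, .oplusR2 _ p => p.labels
  | _, _, .oplusL x p q => x :: (p.labels ++ q.labels)

/-- Number of rule occurrences of a proof. -/
def Proof.size : {Γ : List Formula} → {C : Formula} → Proof Γ C → ℕ
  | _, _, .ax _ => 1
  | _, _, .limpR p => p.size + 1
  | _, _, .limpL p q => p.size + q.size + 1
  | _, _, .ex _ _ _ _ _ p => p.size + 1
  | _, _, .oplusR1 _ p => p.size + 1
  | _, _, .oplusR2 _ p => p.size + 1
  | _, _, .oplusL x p q => p.size + q.size + 1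

/-! ### The encoding of binary decision trees as λ⊕⊸ proofs -/

/-- Transport of a proof along an equality of contexts. -/
def Proof.castL {Γ Γ' : List Formula} {C : Formula} (h : Γ = Γ') (p : Proof Γ C) :
    Proof Γ' C :=
  h ▸ p

/-- The atom `β` (we take `β = atom 0`, and `αᵢ = atom i` for `i ≥ 1`). -/
def betaF : Formula := .atom 0

/-- The formula `𝔹 = β ⊕ β`. -/
def boolF : Formula := .oplus 0 betaF betaF

/-- `Fn n = αₙ ⊸ ⋯ ⊸ α₂ ⊸ α₁ ⊸ β`. -/
def Fn : ℕ → Formula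
  | 0 => betaF
  | n + 1 => .limp (.atom (n + 1)) (Fn n)

/-- The context formula associated with the variable `xᵢ`: `αᵢ` if `xᵢ ∈ I`
(the variable has already been tested), and `αᵢ ⊕ᵢ αᵢ` otherwise. -/
def cFor (I : Finset ℕ) (i : ℕ) : Formula :=
  if i ∈ I then .atom i else .oplus i (.atom i) (.atom i)

/-- The list `[c(a+m), c(a+m-1), …, c(a+1)]` of context formulas for the variables
`x_{a+m}, …, x_{a+1}` (in decreasing order of indices). -/
def csSeg (I : Finset ℕ) (a : ℕ) : ℕ → List Formula
  | 0 => []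
  | m + 1 => cFor I (m + 1 + a) :: csSeg I a m

/-- The context `Γₙ(I)`: the formulas `cFor I i` for `i = n, …, 1` followed by `Fₙ`. -/
def encCtx (n : ℕ) (I : Finset ℕ) : List Formula := csSeg I 0 n ++ [Fn n]

lemma csSeg_split (I : Finset ℕ) (a m₁ m₂ : ℕ) :
    csSeg I a (m₁ + m₂) = csSeg I (a + m₁) m₂ ++ csSeg I a m₁ := by
  induction m₂ with
  | zero => simp [csSeg]
  | succ m ih =>
      have h : m + 1 + (a + m₁) = m₁ + m + 1 + a := by omega
      show csSeg I a (m₁ + m + 1) = csSeg I (a + m₁) (m + 1) ++ csSeg I a m₁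
      rw [csSeg, csSeg, h, ih]
      rfl

lemma cFor_insert_of_ne (I : Finset ℕ) {k i : ℕ} (h : i ≠ k) :
    cFor (insert k I) i = cFor I i := by
  simp [cFor, Finset.mem_insert, h]

lemma csSeg_insert (I : Finset ℕ) (k a : ℕ) :
    ∀ m : ℕ, (k ≤ a ∨ a + m < k) → csSeg (insert k I) a m = csSeg I a m := by
  intro m
  induction m with
  | zero => intro _; rfl
  | succ m ih =>
      intro h
      rw [csSeg, csSeg, cFor_insert_of_ne I (by omega), ih (by omega)]

lemma csSeg_split_at (I : Finset ℕ) {n k : ℕ} (h1 : 1 ≤ k) (h2 : k ≤ n) :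
    csSeg I 0 n = csSeg I k (n - k) ++ cFor I k :: csSeg I 0 (k - 1) := by
  obtain ⟨m, rfl⟩ : ∃ m, k = m + 1 := ⟨k - 1, by omega⟩
  have hn : n = (m + 1) + (n - (m + 1)) := by omega
  conv_lhs => rw [hn]
  rw [csSeg_split I 0 (m + 1) (n - (m + 1)), Nat.zero_add]
  simp [csSeg]

lemma csSeg_insert_split (I : Finset ℕ) {n k : ℕ} (h1 : 1 ≤ k) (h2 : k ≤ n)
    (h3 : k ∉ I) :
    csSeg (insert k I) 0 n =
      csSeg I k (n - k) ++ Formula.atom k :: csSeg I 0 (k - 1) := by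
  rw [csSeg_split_at (insert k I) h1 h2, csSeg_insert I k k (n - k) (Or.inl le_rfl),
    csSeg_insert I k 0 (k - 1) (Or.inr (by omega))]
  congr 1
  simp [cFor]

/-- The proof `β ⊢ 𝔹` selecting the left (`b = 1`) or right (`b = 0`) copy of `β`. -/
def pib : Bool → Proof [betaF] boolF
  | true => .oplusR1 0 (.ax 0)
  | false => .oplusR2 0 (.ax 0)

/-- The proof `νᵢ` of `cFor I i ⊢ αᵢ`: an axiom if `i ∈ I`, and the `⊕†ᵢ` combination
of two axioms otherwise. -/
def nuFor (I : Finset ℕ) (i : ℕ) : Proof [cFor I i] (.atom i) :=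
  if h : i ∈ I then
    Proof.castL (by simp [cFor, h]) (Proof.ax i)
  else
    Proof.castL (by simp [cFor, h]) (Proof.oplusL i (Γ := []) (Proof.ax i) (Proof.ax i))

/-- The chain of `⊸*` rules decomposing `Fₙ` against the subproofs `νᵢ`, ending in
`π_b`; the conclusion is `Fₙ, cₙ, …, c₁ ⊢ 𝔹`. -/
def leafChain (I : Finset ℕ) (b : Bool) : (n : ℕ) → Proof (Fn n :: csSeg I 0 n) boolF
  | 0 => pib b
  | j + 1 =>
      Proof.ex [] [] (csSeg I 0 j) (cFor I (j + 1)) (Fn (j + 1))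
        (Proof.limpL (Γ := [cFor I (j + 1)]) (nuFor I (j + 1)) (leafChain I b j))

/-- Moving the formula `A` to the end of the context, by a sequence of exchange rules. -/
def moveLast {C A : Formula} :
    (L M : List Formula) → Proof (L ++ A :: M) C → Proof ((L ++ M) ++ [A]) C
  | L, [], p => Proof.castL (by simp) p
  | L, B :: M, p =>
      let p' : Proof ((L ++ [B]) ++ A :: M) C :=
        Proof.castL (by simp) (Proof.ex L [] M A B p)
      Proof.castL (by simp) (moveLast (L ++ [B]) M p')

/-- The translation of a leaf labeled `b`, with free variables `I`:
the chain of `⊸*` rules, with `Fₙ` moved back to the end of the context. -/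
def encLeaf (n : ℕ) (I : Finset ℕ) (b : Bool) : Proof (encCtx n I) boolF :=
  moveLast [] (csSeg I 0 n) (leafChain I b n)

lemma encCtx_insert_eq (I : Finset ℕ) {n k : ℕ} (h1 : 1 ≤ k) (h2 : k ≤ n) (h3 : k ∉ I) :
    encCtx n (insert k I) =
      csSeg I k (n - k) ++ Formula.atom k :: (csSeg I 0 (k - 1) ++ [Fn n]) := by
  rw [encCtx, csSeg_insert_split I h1 h2 h3]
  simp

lemma encCtx_eq (I : Finset ℕ) {n k : ℕ} (h1 : 1 ≤ k) (h2 : k ≤ n) (h3 : k ∉ I) :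
    csSeg I k (n - k) ++
        Formula.oplus k (.atom k) (.atom k) :: (csSeg I 0 (k - 1) ++ [Fn n]) =
      encCtx n I := by
  rw [encCtx, csSeg_split_at I h1 h2]
  simp [cFor, h3]

/-- One premise of the `⊕†ₖ` rule in the translation of an internal vertex: the
translation of the subtree, with `αₖ` exchanged with `Fₙ` so as to sit at the end
of the context. -/
def encNodeArm (n k : ℕ) (I : Finset ℕ) (h1 : 1 ≤ k) (h2 : k ≤ n) (h3 : k ∉ I)
    (p : Proof (encCtx n (insert k I)) boolF) :
    Proof ((csSeg I k (n - k) ++ Fn n :: csSeg I 0 (k - 1)) ++ [Formula.atom k]) boolF :=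
  Proof.castL (by simp)
    (Proof.ex (csSeg I k (n - k)) (csSeg I 0 (k - 1)) [] (Formula.atom k) (Fn n)
      (Proof.castL (encCtx_insert_eq I h1 h2 h3) p))

/-- The translation of an internal vertex `(x_k ? φ₀ : φ₁)` with free variables `I`
from the translations of `φ₀` and `φ₁` (with free variables `I ∪ {x_k}`): exchange
`αₖ` with `Fₙ`, apply the `⊕†ₖ` rule, and exchange back. -/
def encNode (n k : ℕ) (I : Finset ℕ) (h1 : 1 ≤ k) (h2 : k ≤ n) (h3 : k ∉ I)
    (p₀ p₁ : Proof (encCtx n (insert k I)) boolF) : Proof (encCtx n I) boolF :=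
  Proof.castL (encCtx_eq I h1 h2 h3)
    (Proof.ex (csSeg I k (n - k)) (csSeg I 0 (k - 1)) []
      (Fn n) (Formula.oplus k (.atom k) (.atom k))
      (Proof.castL (by simp)
        (Proof.oplusL k (Γ := csSeg I k (n - k) ++ Fn n :: csSeg I 0 (k - 1))
          (encNodeArm n k I h1 h2 h3 p₀) (encNodeArm n k I h1 h2 h3 p₁))))

/-- The translation `⟦φ⟧` of a BDT `φ` (over the variables `x₁, …, xₙ`, with free
variables `I`) as a proof of `Γₙ(I) ⊢ 𝔹`. -/
def encAux (n : ℕ) : BDT → (I : Finset ℕ) → Proof (encCtx n I) boolF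
  | .leaf b, I => encLeaf n I b
  | .node k φ₀ φ₁, I =>
      if h : 1 ≤ k ∧ k ≤ n ∧ k ∉ I then
        encNode n k I h.1 h.2.1 h.2.2
          (encAux n φ₀ (insert k I)) (encAux n φ₁ (insert k I))
      else encLeaf n I false

/-- The encoding `⟦φ⟧ : Γₙ(∅) ⊢ 𝔹` of a BDT `φ` over the variables `x₁, …, xₙ`. -/
def enc (n : ℕ) (φ : BDT) : Proof (encCtx n ∅) boolF := encAux n φ ∅

lemma BDT.eval_congr {v w : ℕ → Bool} :
    ∀ φ : BDT, (∀ x ∈ φ.vars, v x = w x) → φ.eval v = φ.eval w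
  | .leaf _, _ => rfl
  | .node x l r, h => by
      simp only [BDT.vars, Finset.mem_insert, Finset.mem_union] at h
      simp only [BDT.eval, h x (Or.inl rfl), BDT.eval_congr l fun y hy => h y (by tauto),
        BDT.eval_congr r fun y hy => h y (by tauto)]

lemma Proof.slicing_castL {Γ Γ' : List Formula} {C : Formula} (h : Γ = Γ') (p : Proof Γ C) :
    (Proof.castL h p).slicing = p.slicing := by
  subst h; rfl

lemma csz_cons (A : Formula) (Γ : List Formula) : csz (A :: Γ) = A.size + csz Γ := by
  simp [csz]

lemma csz_append (Γ Δ : List Formula) : csz (Γ ++ Δ) = csz Γ + csz Δ := by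
  simp [csz]

lemma csz_nil : csz [] = 0 := rfl

lemma Fn_size (n : ℕ) : (Fn n).size = n + 1 := by
  induction n with
  | zero => rfl
  | succ n ih => simp [Fn, Formula.size, ih]; omega

lemma cFor_size (I : Finset ℕ) (i : ℕ) : (cFor I i).size = if i ∈ I then 1 else 2 := by
  unfold cFor; split_ifs <;> rfl

lemma Slice.reindex_reindex (f g : ℕ → ℕ) (s : Slice) :
    Slice.reindex g (Slice.reindex f s) = Slice.reindex (g ∘ f) s := by
  simp [Slice.reindex, Finset.image_image, Sym2.map_comp]

/-- The slice linking `f i` with `g i` for `1 ≤ i ≤ n`, and `x` with `y`. -/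
def linkSlice (n : ℕ) (f g : ℕ → ℕ) (x y : ℕ) : Slice :=
  insert s(x, y) ((Finset.Icc 1 n).image fun i => s(f i, g i))

lemma reindex_linkSlice (h : ℕ → ℕ) (n : ℕ) (f g : ℕ → ℕ) (x y : ℕ) :
    Slice.reindex h (linkSlice n f g x y) = linkSlice n (h ∘ f) (h ∘ g) (h x) (h y) := by
  simp [Slice.reindex, linkSlice, Finset.image_insert, Finset.image_image, Function.comp_def]

lemma linkSlice_congr {n : ℕ} {f g f' g' : ℕ → ℕ} {x y x' y' : ℕ}
    (hf : ∀ i, 1 ≤ i → i ≤ n → f i = f' i) (hg : ∀ i, 1 ≤ i → i ≤ n → g i = g' i)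
    (hx : x = x') (hy : y = y') : linkSlice n f g x y = linkSlice n f' g' x' y' := by
  subst hx hy
  unfold linkSlice
  congr 1
  refine Finset.image_congr fun i hi => ?_
  have hi := Finset.mem_Icc.1 hi
  simp only [hf i hi.1 hi.2, hg i hi.1 hi.2]

lemma linkSlice_succ (n : ℕ) (f g : ℕ → ℕ) (x y : ℕ) :
    linkSlice (n + 1) f g x y = {s(f (n + 1), g (n + 1))} ∪ linkSlice n f g x y := by
  unfold linkSlice
  rw [← Finset.insert_Icc_right_eq_Icc_add_one (by omega : 1 ≤ n + 1), Finset.image_insert,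
    Finset.insert_comm]
  rfl

/-- Number of atoms of `Γₙ(I)` preceding its formula for the variable `xᵢ`. -/
def varOffset (n : ℕ) (I : Finset ℕ) (i : ℕ) : ℕ := csz (csSeg I i (n - i))

lemma varOffset_add_size_le {n : ℕ} (I : Finset ℕ) {i k : ℕ} (hk : k < i) (hi : i ≤ n) :
    varOffset n I i + (cFor I i).size ≤ varOffset n I k := by
  obtain ⟨m, rfl⟩ : ∃ m, i = m + 1 + k := ⟨i - k - 1, by omega⟩
  have h := csSeg_split I k (m + 1) (n - (m + 1 + k))
  rw [show m + 1 + (n - (m + 1 + k)) = n - k by omega, Nat.add_comm k] at h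
  rw [varOffset, varOffset, h, csz_append, csSeg, csz_cons]
  omega

lemma varOffset_succ {n : ℕ} (I : Finset ℕ) {i : ℕ} (hi : i ≤ n) :
    varOffset (n + 1) I i = (cFor I (n + 1)).size + varOffset n I i := by
  rw [varOffset, varOffset, show n + 1 - i = (n - i) + 1 by omega, csSeg, csz_cons,
    show n - i + 1 + i = n + 1 by omega]

lemma varOffset_self (n : ℕ) (I : Finset ℕ) : varOffset n I n = 0 := by
  simp [varOffset, csSeg, csz]

lemma varOffset_insert_of_le {n : ℕ} (I : Finset ℕ) {i k : ℕ} (h : k ≤ i) :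
    varOffset n (insert k I) i = varOffset n I i := by
  rw [varOffset, csSeg_insert _ _ _ _ (Or.inl h), varOffset]

lemma varOffset_insert_of_lt {n : ℕ} {I : Finset ℕ} {i k : ℕ} (h : i < k) (hk : k ≤ n)
    (hI : k ∉ I) : varOffset n I i = varOffset n (insert k I) i + 1 := by
  induction n, hk using Nat.le_induction with
  | base =>
      obtain ⟨m, rfl⟩ : ∃ m, k = m + 1 := ⟨k - 1, by omega⟩
      rw [varOffset_succ _ (by omega), varOffset_succ _ (by omega), varOffset, varOffset,
        csSeg_insert _ _ _ _ (Or.inr (by omega)), cFor_size, cFor_size]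
      simp [hI]
      omega
  | succ n hn ih =>
      rw [varOffset_succ _ (by omega), varOffset_succ _ (by omega), ih,
        cFor_insert_of_ne I (by omega)]
      omega

/-- Which of the atoms of the context formula for `xᵢ` is selected by the valuation `v`. -/
def selector (I : Finset ℕ) (v : ℕ → Bool) (i : ℕ) : ℕ := if i ∈ I then 0 else (v i).toNat

lemma selector_lt_size (I : Finset ℕ) (v : ℕ → Bool) (i : ℕ) :
    selector I v i < (cFor I i).size := by
  rw [cFor_size, selector]
  have := Bool.toNat_lt (v i)
  split_ifs <;> omega

/-- The slice of `Γₙ(I) ⊢ 𝔹` selected by the valuation `v` and the output bit `b`. -/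
def encSlice (n : ℕ) (I : Finset ℕ) (v : ℕ → Bool) (b : Bool) : Slice :=
  linkSlice n (fun i => varOffset n I i + selector I v i) (fun i => varOffset n I 0 + (n - i))
    (varOffset n I 0 + n) (varOffset n I 0 + n + 1 + (!b).toNat)

/-- The counterpart of `encSlice` for the sequent `Fₙ, cₙ, …, c₁ ⊢ 𝔹`. -/
def chainSlice (n : ℕ) (I : Finset ℕ) (v : ℕ → Bool) (b : Bool) : Slice :=
  linkSlice n (fun i => n + 1 + varOffset n I i + selector I v i) (fun i => n - i)
    n (n + 1 + varOffset n I 0 + (!b).toNat)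

lemma mem_slicing_nuFor (I : Finset ℕ) (i : ℕ) (s : Slice) :
    s ∈ (nuFor I i).slicing ↔ ∃ v : ℕ → Bool, s = {s(selector I v i, (cFor I i).size)} := by
  rw [cFor_size]
  by_cases h : i ∈ I
  · simp [nuFor, h, Proof.slicing_castL, Proof.slicing, selector]
  · simp only [nuFor, h, Proof.slicing_castL, Proof.slicing, selector, dif_neg, not_false_eq_true,
      if_false, csz_nil, Formula.size, Slice.reindex, Finset.image_singleton, Sym2.map_mk,
      Finset.mem_union, Finset.mem_singleton]
    constructor
    · rintro (rfl | rfl)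
      · exact ⟨fun _ => false, rfl⟩
      · exact ⟨fun _ => true, rfl⟩
    · rintro ⟨v, rfl⟩
      cases v i <;> simp

lemma chainSlice_succ (j : ℕ) (I : Finset ℕ) (v : ℕ → Bool) (b : Bool) :
    chainSlice (j + 1) I v b =
      Slice.reindex (swapMap 0 (cFor I (j + 1)).size 0 (j + 2))
        ({s(selector I v (j + 1), (cFor I (j + 1)).size)} ∪
          Slice.reindex (fun i => i + ((cFor I (j + 1)).size + 1)) (chainSlice j I v b)) := by
  have hsel := selector_lt_size I v (j + 1)
  have hunion : ∀ (f : ℕ → ℕ) (s t : Slice),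
      Slice.reindex f (s ∪ t) = Slice.reindex f s ∪ Slice.reindex f t :=
    fun f s t => Finset.image_union ..
  rw [hunion, chainSlice, linkSlice_succ, Slice.reindex_reindex, chainSlice, reindex_linkSlice]
  congr 1
  · simp only [Slice.reindex, Finset.image_singleton, Sym2.map_mk, varOffset_self]
    congr 2
    · unfold swapMap; split_ifs <;> omega
    · unfold swapMap; split_ifs <;> omega
  · apply linkSlice_congr
    · intro i h1 h2
      simp only [Function.comp, varOffset_succ I h2]
      unfold swapMap; split_ifs <;> omega
    · intro i h1 h2
      simp only [Function.comp]
      unfold swapMap; split_ifs <;> omega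
    · simp only [Function.comp]
      unfold swapMap; split_ifs <;> omega
    · simp only [Function.comp, varOffset_succ I (Nat.zero_le j)]
      unfold swapMap; split_ifs <;> omega

lemma chainSlice_congr {j : ℕ} {I : Finset ℕ} {v w : ℕ → Bool} (b : Bool)
    (h : ∀ i, 1 ≤ i → i ≤ j → v i = w i) : chainSlice j I v b = chainSlice j I w b := by
  apply linkSlice_congr <;> intros <;> simp_all [selector]

lemma mem_slicing_leafChain (I : Finset ℕ) (b : Bool) (n : ℕ) (s : Slice) :
    s ∈ (leafChain I b n).slicing ↔ ∃ v, s = chainSlice n I v b := by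
  induction n generalizing s with
  | zero =>
      have h : ∀ v, chainSlice 0 I v b = {s(0, 1 + (!b).toNat)} := fun v => by
        simp [chainSlice, linkSlice, varOffset_self]
      cases b <;> simp [h, leafChain, pib, Proof.slicing, Slice.reindex, csz, betaF, Formula.size,
        Fn, csSeg]
  | succ j ih =>
      simp only [leafChain, Proof.slicing, Finset.mem_image, Finset.mem_image₂, csz_nil, csz_cons,
        Fn_size, Formula.size, Nat.add_zero]
      constructor
      · rintro ⟨_, ⟨l, hl, m, hm, rfl⟩, rfl⟩
        obtain ⟨w, rfl⟩ := (mem_slicing_nuFor I (j + 1) l).1 hl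
        obtain ⟨v, rfl⟩ := (ih m).1 hm
        refine ⟨Function.update v (j + 1) (w (j + 1)), ?_⟩
        have hupd : ∀ i, 1 ≤ i → i ≤ j → Function.update v (j + 1) (w (j + 1)) i = v i :=
          fun i _ hi => Function.update_of_ne (by omega) _ _
        rw [chainSlice_succ, chainSlice_congr b hupd]
        simp [selector]
      · rintro ⟨v, rfl⟩
        exact ⟨_, ⟨_, (mem_slicing_nuFor I (j + 1) _).2 ⟨v, rfl⟩, _, (ih _).2 ⟨v, rfl⟩, rfl⟩,
          (chainSlice_succ j I v b).symm⟩

lemma slicing_moveLast {C A : Formula} (L M : List Formula) (p : Proof (L ++ A :: M) C) :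
    (moveLast L M p).slicing =
      p.slicing.image (Slice.reindex (swapMap (csz L) A.size 0 (csz M))) := by
  induction M generalizing L with
  | nil =>
      have h : swapMap (csz L) A.size 0 (csz []) = id := by
        funext i
        rw [csz_nil]
        unfold swapMap; simp only [id]; split_ifs <;> omega
      have h' : Slice.reindex id = id := by
        funext s
        simp [Slice.reindex]
      rw [moveLast, Proof.slicing_castL, h, h', Finset.image_id]
  | cons B M ih =>
      rw [moveLast, Proof.slicing_castL, ih, Proof.slicing_castL, Proof.slicing,
        Finset.image_image]
      congr 1
      funext s
      rw [Function.comp, Slice.reindex_reindex]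
      congr 1
      funext i
      simp only [Function.comp, csz_append, csz_cons, csz_nil]
      unfold swapMap; split_ifs <;> omega

lemma reindex_chainSlice (n : ℕ) (I : Finset ℕ) (v : ℕ → Bool) (b : Bool) :
    Slice.reindex (swapMap 0 (n + 1) 0 (varOffset n I 0)) (chainSlice n I v b) =
      encSlice n I v b := by
  rw [chainSlice, reindex_linkSlice, encSlice]
  apply linkSlice_congr
  · intro i h1 h2
    have := varOffset_add_size_le I h1 h2
    have := selector_lt_size I v i
    simp only [Function.comp]
    unfold swapMap; split_ifs <;> omega
  · intro i h1 h2
    simp only [Function.comp]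
    unfold swapMap; split_ifs <;> omega
  · unfold swapMap; split_ifs <;> omega
  · unfold swapMap; split_ifs <;> omega

lemma mem_slicing_encLeaf (n : ℕ) (I : Finset ℕ) (b : Bool) (s : Slice) :
    s ∈ (encLeaf n I b).slicing ↔ ∃ v, s = encSlice n I v b := by
  have h : (encLeaf n I b).slicing = (leafChain I b n).slicing.image
      (Slice.reindex (swapMap 0 (n + 1) 0 (varOffset n I 0))) := by
    rw [← Fn_size]
    exact slicing_moveLast [] (csSeg I 0 n) (leafChain I b n)
  simp only [h, Finset.mem_image, mem_slicing_leafChain, ← reindex_chainSlice]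
  constructor
  · rintro ⟨_, ⟨v, rfl⟩, rfl⟩; exact ⟨v, rfl⟩
  · rintro ⟨v, rfl⟩; exact ⟨_, ⟨v, rfl⟩, rfl⟩

lemma swapMap_cases (a p b q i : ℕ) :
    (i < a ∧ swapMap a p b q i = i) ∨
    ((a ≤ i ∧ i < a + p) ∧ swapMap a p b q i = i + q + b) ∨
    ((a + p ≤ i ∧ i < a + p + b) ∧ swapMap a p b q i = i - p + q) ∨
    ((a + p + b ≤ i ∧ i < a + p + b + q) ∧ swapMap a p b q i = i - p - b) ∨
    (a + p + b + q ≤ i ∧ swapMap a p b q i = i) := by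
  unfold swapMap; split_ifs <;> omega

lemma slicing_encNode (n k : ℕ) (I : Finset ℕ) (h1 : 1 ≤ k) (h2 : k ≤ n) (h3 : k ∉ I)
    (p₀ p₁ : Proof (encCtx n (insert k I)) boolF) :
    (encNode n k I h1 h2 h3 p₀ p₁).slicing =
      p₀.slicing.image (Slice.reindex fun i => if i ≤ varOffset n I k then i else i + 1) ∪
      p₁.slicing.image (Slice.reindex fun i => if i < varOffset n I k then i else i + 1) := by
  simp only [encNode, encNodeArm, Proof.slicing_castL, Proof.slicing, Finset.image_union,
    Finset.image_image]
  have hcomp : ∀ f g h : ℕ → ℕ, Slice.reindex f ∘ (Slice.reindex g ∘ Slice.reindex h) =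
      Slice.reindex (f ∘ g ∘ h) := by
    intro f g h
    funext s
    simp only [Function.comp_apply, Slice.reindex_reindex]
  have hu : csz (csSeg I k (n - k)) = varOffset n I k := rfl
  simp only [hcomp, csz_append, csz_cons, Fn_size, Formula.size, hu]
  congr 3 <;>
  · funext i
    simp only [Function.comp]
    have hin := swapMap_cases (varOffset n I k) 1 (csz (csSeg I 0 (k - 1))) (n + 1) i
    generalize swapMap _ 1 _ _ i = y at hin ⊢
    have hleft := swapMap_cases (varOffset n I k) (n + 1) (csz (csSeg I 0 (k - 1))) (1 + 1) y
    have hright :=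
      swapMap_cases (varOffset n I k) (n + 1) (csz (csSeg I 0 (k - 1))) (1 + 1) (y + 1)
    split_ifs <;> rcases hin with h | h | h | h | h <;> omega

lemma encSlice_of_not_mem {n k : ℕ} {I : Finset ℕ} (h1 : 1 ≤ k) (h2 : k ≤ n) (h3 : k ∉ I)
    {v : ℕ → Bool} {d : ℕ → ℕ} (hlt : ∀ i < varOffset n I k, d i = i)
    (hgt : ∀ i, varOffset n I k < i → d i = i + 1)
    (heq : d (varOffset n I k) = varOffset n I k + (v k).toNat) (b : Bool) :
    encSlice n I v b = Slice.reindex d (encSlice n (insert k I) v b) := by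
  have hk : varOffset n (insert k I) k = varOffset n I k := varOffset_insert_of_le I le_rfl
  have hT := varOffset_insert_of_lt h1 h2 h3
  have hT' := varOffset_add_size_le (insert k I) h1 h2
  have hs : (cFor (insert k I) k).size = 1 := by simp [cFor_size]
  rw [encSlice, encSlice, reindex_linkSlice]
  apply linkSlice_congr
  · intro i hi hin
    simp only [Function.comp]
    rcases lt_trichotomy i k with h | rfl | h
    · have ho := varOffset_insert_of_lt h h2 h3
      have hl := varOffset_add_size_le (insert k I) h h2
      have hsel : selector (insert k I) v i = selector I v i := by
        simp [selector, h.ne]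
      rw [hgt _ (by omega)]
      omega
    · have hsel : selector (insert i I) v i = 0 := by simp [selector]
      rw [hsel, hk, Nat.add_zero, heq, selector, if_neg h3]
    · have hsel : selector (insert k I) v i = selector I v i := by
        simp [selector, h.ne']
      have hl := varOffset_add_size_le I h hin
      have := selector_lt_size I v i
      rw [varOffset_insert_of_le I h.le, hsel, hlt _ (by omega)]
  · intro i hi hin
    simp only [Function.comp]
    rw [hgt _ (by omega)]
    omega
  · rw [hgt _ (by omega)]
    omega
  · rw [hgt _ (by omega)]
    omega

lemma encSlice_insert_congr {n k : ℕ} {I : Finset ℕ} {v w : ℕ → Bool} (b : Bool)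
    (h : ∀ i, i ≠ k → v i = w i) :
    encSlice n (insert k I) v b = encSlice n (insert k I) w b := by
  apply linkSlice_congr <;> intros
  · simp only [selector, Finset.mem_insert]
    split_ifs with hi
    · rfl
    · rw [h _ fun e => hi (Or.inl e)]
  all_goals rfl

lemma mem_slicing_encAux (n : ℕ) (φ : BDT) (I : Finset ℕ) (hf : φ.Free)
    (hv : ∀ x ∈ φ.vars, (1 ≤ x ∧ x ≤ n) ∧ x ∉ I) (s : Slice) :
    s ∈ (encAux n φ I).slicing ↔ ∃ v, s = encSlice n I v (φ.eval v) := by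
  induction φ generalizing I s with
  | leaf b => exact mem_slicing_encLeaf n I b s
  | node k l r ihl ihr =>
      simp only [BDT.vars, Finset.mem_insert, Finset.mem_union] at hv
      obtain ⟨hkl, hkr, hfl, hfr⟩ := hf
      obtain ⟨⟨h1, h2⟩, h3⟩ := hv k (Or.inl rfl)
      have hvl : ∀ x ∈ l.vars, (1 ≤ x ∧ x ≤ n) ∧ x ∉ insert k I := fun x hx => by
        have := hv x (by tauto)
        have : x ≠ k := fun e => hkl (e ▸ hx)
        simp_all
      have hvr : ∀ x ∈ r.vars, (1 ≤ x ∧ x ≤ n) ∧ x ∉ insert k I := fun x hx => by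
        have := hv x (by tauto)
        have : x ≠ k := fun e => hkr (e ▸ hx)
        simp_all
      have hleft : ∀ (v : ℕ → Bool) (b : Bool), v k = false → encSlice n I v b =
          Slice.reindex (fun i => if i ≤ varOffset n I k then i else i + 1)
            (encSlice n (insert k I) v b) := fun v b hvk =>
        encSlice_of_not_mem h1 h2 h3 (fun i hi => if_pos hi.le) (fun i hi => if_neg (by omega))
          (by simp [hvk]) b
      have hright : ∀ (v : ℕ → Bool) (b : Bool), v k = true → encSlice n I v b =
          Slice.reindex (fun i => if i < varOffset n I k then i else i + 1)
            (encSlice n (insert k I) v b) := fun v b hvk =>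
        encSlice_of_not_mem h1 h2 h3 (fun i hi => if_pos hi) (fun i hi => if_neg (by omega))
          (by simp [hvk]) b
      have hupd : ∀ (v : ℕ → Bool) (b : Bool) (i : ℕ), i ≠ k → Function.update v k b i = v i :=
        fun v b i hi => Function.update_of_ne hi _ _
      rw [encAux, dif_pos ⟨h1, h2, h3⟩, slicing_encNode]
      simp only [Finset.mem_union, Finset.mem_image, ihl _ hfl hvl, ihr _ hfr hvr, BDT.eval]
      constructor
      · rintro (⟨_, ⟨v, rfl⟩, rfl⟩ | ⟨_, ⟨v, rfl⟩, rfl⟩)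
        · refine ⟨Function.update v k false, ?_⟩
          rw [hleft _ _ (Function.update_self ..), encSlice_insert_congr _ (hupd v false),
            BDT.eval_congr (w := v) l fun x hx => hupd v false x fun e => hkl (e ▸ hx)]
          simp
        · refine ⟨Function.update v k true, ?_⟩
          rw [hright _ _ (Function.update_self ..), encSlice_insert_congr _ (hupd v true),
            BDT.eval_congr (w := v) r fun x hx => hupd v true x fun e => hkr (e ▸ hx)]
          simp
      · rintro ⟨v, rfl⟩
        cases hvk : v k with
        | false => exact Or.inl ⟨_, ⟨v, rfl⟩, by simp [hleft v _ hvk]⟩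
        | true => exact Or.inr ⟨_, ⟨v, rfl⟩, by simp [hright v _ hvk]⟩

lemma encSlice_empty_inj {n : ℕ} {v w : ℕ → Bool} {b c : Bool}
    (h : encSlice n ∅ v b = encSlice n ∅ w c) :
    b = c ∧ ∀ i, 1 ≤ i → i ≤ n → v i = w i := by
  have hlt : ∀ (u : ℕ → Bool) (i : ℕ), 1 ≤ i → i ≤ n →
      varOffset n ∅ i + selector ∅ u i < varOffset n ∅ 0 := fun u i h1 h2 => by
    have := varOffset_add_size_le ∅ h1 h2
    have := selector_lt_size ∅ u i
    omega
  have htoNat : ∀ {x y : Bool}, x.toNat = y.toNat → x = y := by decide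
  constructor
  · have hm : s(varOffset n ∅ 0 + n, varOffset n ∅ 0 + n + 1 + (!b).toNat) ∈
        encSlice n ∅ w c := by
      rw [← h]; exact Finset.mem_insert_self _ _
    simp only [encSlice, linkSlice, Finset.mem_insert, Finset.mem_image, Finset.mem_Icc,
      Sym2.eq_iff] at hm
    rcases hm with hm | ⟨i, ⟨h1, h2⟩, hm⟩
    · exact Bool.not_inj (htoNat (by omega))
    · have := hlt w i h1 h2
      omega
  · intro i h1 h2
    have hm : s(varOffset n ∅ i + selector ∅ v i, varOffset n ∅ 0 + (n - i)) ∈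
        encSlice n ∅ w c := by
      rw [← h]
      exact Finset.mem_insert_of_mem (Finset.mem_image.2 ⟨i, Finset.mem_Icc.2 ⟨h1, h2⟩, rfl⟩)
    simp only [encSlice, linkSlice, Finset.mem_insert, Finset.mem_image, Finset.mem_Icc,
      Sym2.eq_iff] at hm
    have hi := hlt v i h1 h2
    rcases hm with hm | ⟨j, ⟨hj1, hj2⟩, hm⟩
    · omega
    · have hj := hlt w j hj1 hj2
      obtain rfl : j = i := by omega
      have : selector ∅ v j = selector ∅ w j := by omega
      exact htoNat (by simpa [selector] using this)

/-- **BDT equivalence reduces to proof equivalence.**  Two free BDTs `φ` and `ψ` over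
the variables `x₁, …, xₙ` are equivalent iff their λ⊕⊸ encodings are equivalent
proofs of `Γₙ(∅) ⊢ 𝔹`, i.e. iff `𝒮(⟦φ⟧) = 𝒮(⟦ψ⟧)`. -/
theorem bdt_equiv_iff_enc_equiv
    (n : ℕ) (φ ψ : BDT) (hφf : φ.Free) (hψf : ψ.Free)
    (hφv : ∀ x ∈ φ.vars, 1 ≤ x ∧ x ≤ n) (hψv : ∀ x ∈ ψ.vars, 1 ≤ x ∧ x ≤ n) :
    BDT.Equiv φ ψ ↔ (enc n φ).slicing = (enc n ψ).slicing := by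
  have hmem : ∀ χ : BDT, χ.Free → (∀ x ∈ χ.vars, 1 ≤ x ∧ x ≤ n) → ∀ s : Slice,
      s ∈ (enc n χ).slicing ↔ ∃ v, s = encSlice n ∅ v (χ.eval v) := fun χ hf hv s =>
    mem_slicing_encAux n χ ∅ hf (fun x hx => ⟨hv x hx, Finset.notMem_empty x⟩) s
  constructor
  · intro h
    ext s
    simp only [hmem φ hφf hφv, hmem ψ hψf hψv, h _]
  · intro h v
    have hs := (hmem φ hφf hφv _).2 ⟨v, rfl⟩
    rw [h] at hs
    obtain ⟨w, hw⟩ := (hmem ψ hψf hψv _).1 hs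
    obtain ⟨heval, hvw⟩ := encSlice_empty_inj hw
    rw [heval, BDT.eval_congr ψ fun x hx => (hvw x (hψv x hx).1 (hψv x hx).2).symm]
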